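/- Let p ≥ 2 be an integer, and let α, β ∈ ℂ satisfy |α| ≥ |β| ≥ 1. Let (λ_r)_{r ≥ 0} and (a_r)_{r ≥ 0} be sequences of complex numbers such that: (1) for every integer r ≥ 3, λ_r − p^{3/2}(α⁻¹ + β + β⁻¹)·λ_{r−1} + p³(α⁻¹β + α⁻¹β⁻¹ + 1)·λ_{r−2} − p^{9/2}α⁻¹·λ_{r−3} = p^{3r/2}·(α^r − p⁻¹·α^{r−2}); and (2) λ_1 = p^{3/2}·a_1 and λ_r = p^{3r/2}·(a_r − p⁻¹·a_{r−2}) for every r ≥ 2. Then for every integer r₀ ≥ 0 there exists an integer r with r₀ ≤ r ≤ r₀ + 5 such that |a_r| ≥ |α|^r / 32. -/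

import Mathlib

/-- The real power `p ^ (3r/2)` is the `r`-th natural power of `p ^ (3/2)`. -/
lemma rpow_three_mul_div_two {p : ℝ} (hp : 0 ≤ p) (r : ℕ) :
    p ^ ((3 * (r : ℝ)) / 2) = (p ^ ((3 : ℝ) / 2)) ^ r := by
  rw [← Real.rpow_mul_natCast hp]
  ring_nf

lemma norm_sub_mul_le_of_le {x y c : ℂ} {k M : ℝ} (hx : ‖x‖ ≤ M) (hy : ‖y‖ ≤ M)
    (hc : ‖c‖ ≤ k) : ‖x - c * y‖ ≤ (1 + k) * M := by
  have hk : 0 ≤ k := (norm_nonneg c).trans hc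
  calc ‖x - c * y‖ ≤ ‖x‖ + ‖c‖ * ‖y‖ := by simpa using norm_sub_le x (c * y)
    _ ≤ M + k * M := by gcongr
    _ = (1 + k) * M := by ring

/-- The recursion satisfied by the normalised coefficients `u r = a r / α ^ r`, written as the
composition of four first-order difference operators, bounds them from below. -/
lemma exists_lt_norm_of_factored_recursion {c d e f : ℂ} (hc : ‖c‖ ≤ 1 / 2) (hd : ‖d‖ ≤ 1)
    (he : ‖e‖ ≤ 1) (hf : ‖f‖ ≤ 1) (u v w z : ℕ → ℂ)
    (hv : ∀ j, v j = u (j + 2) - c * u j) (hw : ∀ j, w j = v (j + 1) - d * v j)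
    (hz : ∀ j, z j = w (j + 1) - e * w j) {n : ℕ} (h : z (n + 1) - f * z n = 1 - c) :
    ∃ r, n ≤ r ∧ r ≤ n + 5 ∧ 1 / 32 < ‖u r‖ := by
  by_contra! hu
  have hvb : ∀ j, n ≤ j → j ≤ n + 3 → ‖v j‖ ≤ (1 + 1 / 2) * (1 / 32) := fun j h₁ h₂ => by
    rw [hv]
    exact norm_sub_mul_le_of_le (hu _ (by lia) (by lia)) (hu _ h₁ (by lia)) hc
  have hwb : ∀ j, n ≤ j → j ≤ n + 2 → ‖w j‖ ≤ (1 + 1) * ((1 + 1 / 2) * (1 / 32)) :=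
    fun j h₁ h₂ => by
      rw [hw]
      exact norm_sub_mul_le_of_le (hvb _ (by lia) (by lia)) (hvb _ h₁ (by lia)) hd
  have hzb : ∀ j, n ≤ j → j ≤ n + 1 → ‖z j‖ ≤ (1 + 1) * ((1 + 1) * ((1 + 1 / 2) * (1 / 32))) :=
    fun j h₁ h₂ => by
      rw [hz]
      exact norm_sub_mul_le_of_le (hwb _ (by lia) (by lia)) (hwb _ h₁ (by lia)) he
  have hupper := norm_sub_mul_le_of_le (hzb (n + 1) (by lia) le_rfl) (hzb n le_rfl (by lia)) hf
  have hlower : 1 - ‖c‖ ≤ ‖1 - c‖ := by simpa using norm_sub_norm_le (1 : ℂ) c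
  rw [h] at hupper
  linarith


/-- If `p ≥ 2`, `|α| ≥ |β| ≥ 1`, the sequence `(λ_r)` satisfies the Shimura recursion for
`r ≥ 3`, and `(a_r)` is related to `(λ_r)` by `λ_1 = p^{3/2}a_1` and
`λ_r = p^{3r/2}(a_r − p⁻¹a_{r−2})` for `r ≥ 2`, then for every `r₀ ≥ 0` there is
`r₀ ≤ r ≤ r₀ + 5` with `|a_r| ≥ |α|^r / 32`. -/
theorem fourier_coefficient_lower_bound
    (p : ℕ) (hp : 2 ≤ p) (α β : ℂ)
    (hβ : 1 ≤ ‖β‖) (hαβ : ‖β‖ ≤ ‖α‖)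
    (lam a : ℕ → ℂ)
    (hrec : ∀ r : ℕ, 3 ≤ r →
      lam r - (((p : ℝ) ^ ((3:ℝ)/2) : ℝ) : ℂ) * (α⁻¹ + β + β⁻¹) * lam (r - 1)
        + (p : ℂ) ^ 3 * (α⁻¹ * β + α⁻¹ * β⁻¹ + 1) * lam (r - 2)
        - (((p : ℝ) ^ ((9:ℝ)/2) : ℝ) : ℂ) * α⁻¹ * lam (r - 3)
      = (((p : ℝ) ^ ((3 * (r : ℝ)) / 2) : ℝ) : ℂ) * (α ^ r - (p : ℂ)⁻¹ * α ^ (r - 2)))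
    (h1 : lam 1 = (((p : ℝ) ^ ((3:ℝ)/2) : ℝ) : ℂ) * a 1)
    (h2 : ∀ r : ℕ, 2 ≤ r →
      lam r = (((p : ℝ) ^ ((3 * (r : ℝ)) / 2) : ℝ) : ℂ) * (a r - (p : ℂ)⁻¹ * a (r - 2))) :
    ∀ r₀ : ℕ, ∃ r : ℕ, r₀ ≤ r ∧ r ≤ r₀ + 5 ∧
      ‖α‖ ^ r / 32 ≤ ‖a r‖ := by
  intro n
  have hα : 1 ≤ ‖α‖ := hβ.trans hαβ
  have hα0 : α ≠ 0 := norm_pos_iff.1 (by linarith)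
  have hβ0 : β ≠ 0 := norm_pos_iff.1 (by linarith)
  have hp0 : (p : ℂ) ≠ 0 := by exact_mod_cast (by lia : p ≠ 0)
  have hpR : (2 : ℝ) ≤ p := by exact_mod_cast hp
  have hpos : (0 : ℝ) ≤ p := by linarith
  simp only [rpow_three_mul_div_two hpos, Complex.ofReal_pow] at hrec h2
  have h9 : (p : ℝ) ^ ((9 : ℝ) / 2) = ((p : ℝ) ^ ((3 : ℝ) / 2)) ^ 3 := by
    rw [← Real.rpow_mul_natCast hpos]
    norm_num
  have h3 : (p : ℂ) ^ 3 = (((p : ℝ) ^ ((3 : ℝ) / 2) : ℝ) : ℂ) ^ 2 := by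
    have : (p : ℝ) ^ 3 = ((p : ℝ) ^ ((3 : ℝ) / 2)) ^ 2 := by
      rw [← Real.rpow_mul_natCast hpos, ← Real.rpow_natCast]
      norm_num
    exact_mod_cast this
  have hq0 : (((p : ℝ) ^ ((3 : ℝ) / 2) : ℝ) : ℂ) ≠ 0 := by
    exact_mod_cast (Real.rpow_pos_of_pos (by linarith) _).ne'
  rw [h9, h3, Complex.ofReal_pow] at hrec
  generalize (((p : ℝ) ^ ((3 : ℝ) / 2) : ℝ) : ℂ) = q at hrec h2 hq0
  have hinv : ‖α⁻¹‖ ≤ 1 := by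
    rw [norm_inv]
    exact inv_le_one_of_one_le₀ hα
  have hinvβ : ‖β⁻¹‖ ≤ 1 := by
    rw [norm_inv]
    exact inv_le_one_of_one_le₀ hβ
  have hc : ‖(p : ℂ)⁻¹ * (α⁻¹ * α⁻¹)‖ ≤ 1 / 2 := by
    have hpinv : ‖(p : ℂ)⁻¹‖ ≤ 1 / 2 := by
      rw [norm_inv, Complex.norm_natCast, one_div]
      gcongr
    rw [norm_mul, norm_mul]
    calc _ ≤ (1 / 2 : ℝ) * (1 * 1) := by gcongr
      _ = 1 / 2 := by norm_num
  have hd : ‖α⁻¹ * α⁻¹‖ ≤ 1 := by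
    rw [norm_mul]
    exact mul_le_one₀ hinv (norm_nonneg _) hinv
  have he : ‖β * α⁻¹‖ ≤ 1 := by
    rw [norm_mul, norm_inv]
    exact mul_inv_le_one_of_le₀ hαβ (norm_nonneg _)
  have hf : ‖β⁻¹ * α⁻¹‖ ≤ 1 := by
    rw [norm_mul]
    exact mul_le_one₀ hinvβ (norm_nonneg _) hinv
  have hfourier : a (n + 5) - (p : ℂ)⁻¹ * a (n + 3)
      - (α⁻¹ + β + β⁻¹) * (a (n + 4) - (p : ℂ)⁻¹ * a (n + 2))
      + (α⁻¹ * β + α⁻¹ * β⁻¹ + 1) * (a (n + 3) - (p : ℂ)⁻¹ * a (n + 1))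
      - α⁻¹ * (a (n + 2) - (p : ℂ)⁻¹ * a n)
      = α ^ (n + 5) - (p : ℂ)⁻¹ * α ^ (n + 3) := by
    have H := hrec (n + 5) (by lia)
    have e5 := h2 (n + 5) (by lia)
    have e4 := h2 (n + 4) (by lia)
    have e3 := h2 (n + 3) (by lia)
    have e2 := h2 (n + 2) (by lia)
    simp only [Nat.add_sub_cancel, Nat.reduceSubDiff] at H e5 e4 e3 e2
    rw [e5, e4, e3, e2] at H
    apply mul_left_cancel₀ (pow_ne_zero (n + 5) hq0)
    linear_combination H
  let u : ℕ → ℂ := fun r => a r / α ^ r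
  let v : ℕ → ℂ := fun j => u (j + 2) - (p : ℂ)⁻¹ * (α⁻¹ * α⁻¹) * u j
  let w : ℕ → ℂ := fun j => v (j + 1) - α⁻¹ * α⁻¹ * v j
  let z : ℕ → ℂ := fun j => w (j + 1) - β * α⁻¹ * w j
  obtain ⟨r, hnr, hrn, hr⟩ := exists_lt_norm_of_factored_recursion hc hd he hf u v w z
    (fun _ => rfl) (fun _ => rfl) (fun _ => rfl) (n := n) (by
      have hu : ∀ r, a r = α ^ r * u r := fun r =>
        (mul_div_cancel₀ _ (pow_ne_zero r hα0)).symm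
      simp only [hu] at hfourier
      simp only [z, w, v]
      clear_value u
      field_simp at hfourier ⊢
      apply mul_left_cancel₀ (pow_ne_zero n hα0)
      linear_combination hfourier)
  refine ⟨r, hnr, hrn, ?_⟩
  have hαr : 0 < ‖α‖ ^ r := by positivity
  simp only [u, norm_div, norm_pow] at hr
  rw [lt_div_iff₀ hαr] at hr
  linarith
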